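/- Let α_i, β_i (i ∈ ℕ), α, β be p.m.p. actions of a countably infinite group Γ such that for every finite S' ⊆ Γ and every k' ∈ ℕ⁺, dist_H(C(α_i,S',k'), C(α,S',k')) → 0, dist_H(C(β_i,S',k'), C(β,S',k')) → 0, and dist_H(C(α_i×β_i,S',k'), C(α×β,S',k')) → 0 as i → ∞. Then for every finite S ⊆ Γ, every k ∈ ℕ⁺, and every ε > 0, one has N_{S,k}(α_i,β_i,ε) ≤ N_{S,k}(α,β,ε/3) for all sufficiently large i. -/

import Mathlib

open MeasureTheory Filter Topology

/-- A probability-measure-preserving (p.m.p.) action of a group `Γ`,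
bundled together with the probability space it acts on. -/
structure PMP (Γ : Type) [Group Γ] where
  /-- the underlying space -/
  X : Type
  /-- the σ-algebra -/
  [mX : MeasurableSpace X]
  /-- the measure -/
  μ : @Measure X mX
  /-- the measure is a probability measure -/
  [prob : IsProbabilityMeasure μ]
  /-- the action map -/
  act : Γ → X → X
  one_act : ∀ x, act 1 x = x
  mul_act : ∀ γ δ x, act (γ * δ) x = act γ (act δ x)
  /-- each group element acts by a measure-preserving (in particular measurable) map -/
  preserves : ∀ γ, MeasurePreserving (act γ) μ μ

attribute [instance] PMP.mX PMP.prob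

variable {Γ : Type} [Group Γ]

/-- A p.m.p. action is free if almost every point has trivial stabilizer. -/
def PMP.Free (a : PMP Γ) : Prop :=
  a.μ {x | ∀ γ : Γ, γ ≠ 1 → a.act γ x ≠ x} = 1

/-- The vector `M^α_{S,k}[f] ∈ [0,1]^{S×k×k}`, defined by
`M^α_{S,k}[f](γ,i,j) = μ {x | f x = i ∧ f (γ • x) = j}`. -/
noncomputable def PMP.M (a : PMP Γ) (S : Finset Γ) (k : ℕ) (f : a.X → Fin k) :
    ↥S × Fin k × Fin k → ℝ :=
  fun q => (a.μ {x | f x = q.2.1 ∧ f (a.act (q.1 : Γ) x) = q.2.2}).toReal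

/-- `C(α,S,k)`: the closure of the set of vectors `M^α_{S,k}[f]`, where `f` ranges over
measurable maps `X → k`, taken in `[0,1]^{S×k×k}`.  (The space `↥S × Fin k × Fin k → ℝ`
carries the sup metric `dist_∞`, since the product distance on a finite product of copies
of `ℝ` is the max of the coordinate distances.) -/
noncomputable def PMP.C (a : PMP Γ) (S : Finset Γ) (k : ℕ) :
    Set (↥S × Fin k × Fin k → ℝ) :=
  closure {v | ∃ f : a.X → Fin k, Measurable f ∧ a.M S k f = v}

/-- The product of two p.m.p. actions:  `γ • (x, y) = (γ • x, γ • y)` on `(X × Y, μ × ν)`. -/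
noncomputable def PMP.prod (a b : PMP Γ) : PMP Γ where
  X := a.X × b.X
  μ := a.μ.prod b.μ
  act γ p := (a.act γ p.1, b.act γ p.2)
  one_act := by intro p; simp [a.one_act, b.one_act]
  mul_act := by intro γ δ p; simp [a.mul_act, b.mul_act]
  preserves γ := (a.preserves γ).prod (b.preserves γ)

/-- `f ∈ Step_{k,N}(X,μ;Y,ν)`: `f = φ ∘ (g,h)` for measurable `g : X → N`, `h : Y → N`
and some `φ : N × N → k`. -/
def IsStep {Γ : Type} [Group Γ] (a b : PMP Γ) (k N : ℕ)
    (f : (a.prod b).X → Fin k) : Prop :=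
  ∃ (g : a.X → Fin N) (h : b.X → Fin N) (φ : Fin N × Fin N → Fin k),
    Measurable g ∧ Measurable h ∧ ∀ p : a.X × b.X, f p = φ (g p.1, h p.2)

/-- The set `{M^{α×β}_{S,k}[f] : f ∈ Step_{k,N}}` is an ε-net in `C(α×β,S,k)`:
every point of `C(α×β,S,k)` is at `dist_∞`-distance `< ε` from a point of this set. -/
def StepNet {Γ : Type} [Group Γ] (a b : PMP Γ) (S : Finset Γ) (k N : ℕ) (ε : ℝ) : Prop :=
  ∀ v ∈ (a.prod b).C S k, ∃ f : (a.prod b).X → Fin k,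
    IsStep a b k N f ∧ dist v ((a.prod b).M S k f) < ε

/-- `N_{S,k}(α,β,ε)`: the least `N ∈ ℕ⁺` such that `{M^{α×β}_{S,k}[f] : f ∈ Step_{k,N}}`
is an ε-net in `C(α×β,S,k)`. -/
noncomputable def NStep {Γ : Type} [Group Γ] (a b : PMP Γ) (S : Finset Γ) (k : ℕ)
    (ε : ℝ) : ℕ :=
  sInf {N : ℕ | 0 < N ∧ StepNet a b S k N ε}

namespace PMP

lemma M_nonneg (a : PMP Γ) (S : Finset Γ) (k : ℕ) (f : a.X → Fin k)
    (q : ↥S × Fin k × Fin k) : 0 ≤ a.M S k f q :=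
  ENNReal.toReal_nonneg

lemma M_le_one (a : PMP Γ) (S : Finset Γ) (k : ℕ) (f : a.X → Fin k)
    (q : ↥S × Fin k × Fin k) : a.M S k f q ≤ 1 :=
  measureReal_le_one

lemma C_subset_Icc (a : PMP Γ) (S : Finset Γ) (k : ℕ) : a.C S k ⊆ Set.Icc 0 1 := by
  refine closure_minimal ?_ isClosed_Icc
  rintro _ ⟨f, -, rfl⟩
  exact ⟨fun q => a.M_nonneg S k f q, fun q => a.M_le_one S k f q⟩

lemma isBounded_C (a : PMP Γ) (S : Finset Γ) (k : ℕ) : Bornology.IsBounded (a.C S k) :=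
  (Metric.isBounded_Icc 0 1).subset (a.C_subset_Icc S k)

lemma M_mem_C (a : PMP Γ) (S : Finset Γ) (k : ℕ) {f : a.X → Fin k} (hf : Measurable f) :
    a.M S k f ∈ a.C S k :=
  subset_closure ⟨f, hf, rfl⟩

lemma nonempty_C (a : PMP Γ) (S : Finset Γ) {k : ℕ} (hk : 0 < k) : (a.C S k).Nonempty :=
  ⟨_, a.M_mem_C S k (measurable_const (a := (⟨0, hk⟩ : Fin k)))⟩

lemma exists_dist_lt_of_hausdorffDist_C_lt {a b : PMP Γ} {S : Finset Γ} {k : ℕ} (hk : 0 < k)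
    {δ : ℝ} (h : Metric.hausdorffDist (a.C S k) (b.C S k) < δ) :
    (∀ v ∈ a.C S k, ∃ w ∈ b.C S k, dist v w < δ) ∧
      ∀ w ∈ b.C S k, ∃ v ∈ a.C S k, dist v w < δ := by
  have fin := Metric.hausdorffEDist_ne_top_of_nonempty_of_bounded (a.nonempty_C S hk)
    (b.nonempty_C S hk) (a.isBounded_C S k) (b.isBounded_C S k)
  exact ⟨fun v hv => Metric.exists_dist_lt_of_hausdorffDist_lt hv h fin,
    fun w hw => Metric.exists_dist_lt_of_hausdorffDist_lt' hw h fin⟩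

lemma exists_dist_M_lt {a b : PMP Γ} {S : Finset Γ} {k : ℕ} (hk : 0 < k) {δ : ℝ}
    (h : Metric.hausdorffDist (a.C S k) (b.C S k) < δ) {g : b.X → Fin k} (hg : Measurable g) :
    ∃ f : a.X → Fin k, Measurable f ∧ dist (a.M S k f) (b.M S k g) < δ := by
  obtain ⟨v, hv, hvg⟩ := (exists_dist_lt_of_hausdorffDist_C_lt hk h).2 _ (b.M_mem_C S k hg)
  obtain ⟨_, ⟨f, hf, rfl⟩, hfv⟩ := Metric.mem_closure_iff.1 hv _ (sub_pos.2 hvg)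
  refine ⟨f, hf, ?_⟩
  have := dist_triangle_left (a.M S k f) (b.M S k g) v
  linarith

/-- Changing `f` on a set of measure `η` changes `M f` by at most `2 * η`. -/
lemma dist_M_le (a : PMP Γ) (S : Finset Γ) (k : ℕ) {f f' : a.X → Fin k} (hf : Measurable f)
    (hf' : Measurable f') : dist (a.M S k f) (a.M S k f') ≤ 2 * a.μ.real {x | f x ≠ f' x} := by
  have key : ∀ {f f' : a.X → Fin k}, Measurable f → Measurable f' → ∀ q : ↥S × Fin k × Fin k,
      a.M S k f q ≤ a.M S k f' q + 2 * a.μ.real {x | f x ≠ f' x} := by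
    intro f f' hf hf' q
    set D := {x | f x ≠ f' x} with hD_def
    have hD : MeasurableSet D := (measurableSet_eq_fun hf hf').compl
    have hpre : a.μ.real (a.act q.1 ⁻¹' D) = a.μ.real D := by
      simp only [measureReal_def, (a.preserves q.1).measure_preimage hD.nullMeasurableSet]
    have hsub : {x | f x = q.2.1 ∧ f (a.act (q.1 : Γ) x) = q.2.2} ⊆
        {x | f' x = q.2.1 ∧ f' (a.act (q.1 : Γ) x) = q.2.2} ∪ (D ∪ a.act q.1 ⁻¹' D) := by
      rintro x ⟨h1, h2⟩
      by_cases hx : f x = f' x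
      · by_cases hx' : f (a.act q.1 x) = f' (a.act q.1 x)
        · exact .inl ⟨hx ▸ h1, hx' ▸ h2⟩
        · exact .inr (.inr hx')
      · exact .inr (.inl hx)
    have h1 := measureReal_mono hsub (measure_ne_top a.μ _)
    have h2 := measureReal_union_le (μ := a.μ)
      {x | f' x = q.2.1 ∧ f' (a.act (q.1 : Γ) x) = q.2.2} (D ∪ a.act q.1 ⁻¹' D)
    have h3 := measureReal_union_le (μ := a.μ) D (a.act q.1 ⁻¹' D)
    change a.μ.real _ ≤ a.μ.real _ + _
    linarith
  refine (dist_pi_le_iff (by positivity)).2 fun q => ?_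
  have h1 := key hf hf' q
  have h2 := key hf' hf q
  simp only [ne_comm (a := f' _)] at h2
  rw [Real.dist_eq, abs_sub_le_iff]
  constructor <;> linarith

lemma M_prod_step (a b : PMP Γ) (S : Finset Γ) {k N : ℕ} {g : a.X → Fin N} {h : b.X → Fin N}
    (hg : Measurable g) (hh : Measurable h) (φ : Fin N × Fin N → Fin k)
    (q : ↥S × Fin k × Fin k) :
    (a.prod b).M S k (fun p => φ (g p.1, h p.2)) q =
      ∑ t : (Fin N × Fin N) × (Fin N × Fin N) with
        φ (t.1.1, t.2.1) = q.2.1 ∧ φ (t.1.2, t.2.2) = q.2.2,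
        a.M S N g (q.1, t.1) * b.M S N h (q.1, t.2) := by
  have hgm : ∀ t : Fin N × Fin N,
      MeasurableSet {x | g x = t.1 ∧ g (a.act (q.1 : Γ) x) = t.2} := fun t =>
    (hg (measurableSet_singleton t.1)).inter
      ((hg.comp (a.preserves q.1).measurable) (measurableSet_singleton t.2))
  have hhm : ∀ t : Fin N × Fin N,
      MeasurableSet {x | h x = t.1 ∧ h (b.act (q.1 : Γ) x) = t.2} := fun t =>
    (hh (measurableSet_singleton t.1)).inter
      ((hh.comp (b.preserves q.1).measurable) (measurableSet_singleton t.2))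
  have hset : {p : a.X × b.X | φ (g p.1, h p.2) = q.2.1 ∧
      φ (g (a.act q.1 p.1), h (b.act q.1 p.2)) = q.2.2} =
      ⋃ t ∈ Finset.univ.filter fun t : (Fin N × Fin N) × (Fin N × Fin N) =>
        φ (t.1.1, t.2.1) = q.2.1 ∧ φ (t.1.2, t.2.2) = q.2.2,
        {x | g x = t.1.1 ∧ g (a.act (q.1 : Γ) x) = t.1.2} ×ˢ
          {y | h y = t.2.1 ∧ h (b.act (q.1 : Γ) y) = t.2.2} := by
    ext ⟨x, y⟩
    simp only [Set.mem_ofPred_eq, Finset.mem_filter, Finset.mem_univ, true_and, Set.mem_iUnion,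
      Set.mem_prod, exists_prop]
    constructor
    · intro hp
      exact ⟨((g x, g (a.act q.1 x)), (h y, h (b.act q.1 y))), hp, ⟨rfl, rfl⟩, rfl, rfl⟩
    · rintro ⟨t, ht, ⟨h1, h2⟩, h3, h4⟩
      rwa [h1, h2, h3, h4]
  change (a.μ.prod b.μ).real {p : a.X × b.X | φ (g p.1, h p.2) = q.2.1 ∧
      φ (g (a.act q.1 p.1), h (b.act q.1 p.2)) = q.2.2} = _
  rw [hset, measureReal_biUnion_finset]
  · exact Finset.sum_congr rfl fun t _ => measureReal_prod_prod _ _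
  · intro t _ t' _ htt'
    refine Set.disjoint_left.2 ?_
    rintro ⟨x, y⟩ ⟨⟨h1, h2⟩, h3, h4⟩ ⟨⟨h1', h2'⟩, h3', h4'⟩
    refine htt' (Prod.ext (Prod.ext ?_ ?_) (Prod.ext ?_ ?_))
    exacts [h1.symm.trans h1', h2.symm.trans h2', h3.symm.trans h3', h4.symm.trans h4']
  · exact fun t _ => (hgm t.1).prod (hhm t.2)

lemma dist_M_prod_step_le {a b a' b' : PMP Γ} {S : Finset Γ} {k N : ℕ}
    {g : a.X → Fin N} {h : b.X → Fin N} {g' : a'.X → Fin N} {h' : b'.X → Fin N}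
    (hg : Measurable g) (hh : Measurable h) (hg' : Measurable g') (hh' : Measurable h')
    (φ : Fin N × Fin N → Fin k) :
    dist ((a.prod b).M S k fun p => φ (g p.1, h p.2))
        ((a'.prod b').M S k fun p => φ (g' p.1, h' p.2)) ≤
      (N : ℝ) ^ 4 * (dist (a.M S N g) (a'.M S N g') + dist (b.M S N h) (b'.M S N h')) := by
  refine (dist_pi_le_iff (by positivity)).2 fun q => ?_
  rw [M_prod_step a b S hg hh, M_prod_step a' b' S hg' hh', Real.dist_eq,
    ← Finset.sum_sub_distrib]
  have hterm : ∀ t : (Fin N × Fin N) × (Fin N × Fin N),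
      |a.M S N g (q.1, t.1) * b.M S N h (q.1, t.2) -
        a'.M S N g' (q.1, t.1) * b'.M S N h' (q.1, t.2)| ≤
      dist (a.M S N g) (a'.M S N g') + dist (b.M S N h) (b'.M S N h') := by
    intro t
    have h1 := dist_le_pi_dist (a.M S N g) (a'.M S N g') (q.1, t.1)
    have h2 := dist_le_pi_dist (b.M S N h) (b'.M S N h') (q.1, t.2)
    rw [Real.dist_eq] at h1 h2
    calc _ = |(a.M S N g (q.1, t.1) - a'.M S N g' (q.1, t.1)) * b.M S N h (q.1, t.2) +
          a'.M S N g' (q.1, t.1) * (b.M S N h (q.1, t.2) - b'.M S N h' (q.1, t.2))| := by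
          ring_nf
      _ ≤ |a.M S N g (q.1, t.1) - a'.M S N g' (q.1, t.1)| * 1 +
          1 * |b.M S N h (q.1, t.2) - b'.M S N h' (q.1, t.2)| := by
          refine (abs_add_le _ _).trans ?_
          rw [abs_mul, abs_mul, abs_of_nonneg (M_nonneg b ..), abs_of_nonneg (M_nonneg a' ..)]
          gcongr
          exacts [M_le_one .., M_le_one ..]
      _ ≤ _ := by linarith
  refine (Finset.abs_sum_le_sum_abs _ _).trans
    ((Finset.sum_le_sum_of_subset_of_nonneg (Finset.subset_univ _)
      fun _ _ _ => abs_nonneg _).trans ((Finset.sum_le_sum fun t _ => hterm t).trans_eq ?_))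
  simp only [Finset.sum_const, Finset.card_univ, Fintype.card_prod, Fintype.card_fin, nsmul_eq_mul]
  push_cast
  ring

end PMP

lemma IsStep.mono {a b : PMP Γ} {k N N' : ℕ} {f : (a.prod b).X → Fin k}
    (hf : IsStep a b k N f) (hN : N ≤ N') : IsStep a b k N' f := by
  obtain ⟨g, h, φ, hg, hh, hfe⟩ := hf
  obtain ⟨p⟩ : Nonempty (a.X × b.X) := (a.prod b).μ.nonempty_of_neZero
  have : Nonempty (Fin N) := ⟨g p.1⟩
  have hinj := Function.leftInverse_invFun (Fin.castLE_injective hN)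
  refine ⟨Fin.castLE hN ∘ g, Fin.castLE hN ∘ h,
    fun t => φ (Function.invFun (Fin.castLE hN) t.1, Function.invFun (Fin.castLE hN) t.2),
    (measurable_of_finite _).comp hg, (measurable_of_finite _).comp hh, fun p => ?_⟩
  simp only [Function.comp_apply, hinj _, hfe p]

lemma IsStep.measurable {a b : PMP Γ} {k N : ℕ} {f : (a.prod b).X → Fin k}
    (hf : IsStep a b k N f) : Measurable f := by
  obtain ⟨g, h, φ, hg, hh, hfe⟩ := hf
  rw [show f = fun p : a.X × b.X => φ (g p.1, h p.2) from funext hfe]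
  exact (measurable_of_finite φ).comp
    ((hg.comp measurable_fst).prodMk (hh.comp measurable_snd))

lemma exists_isStep_of_finite {a b : PMP Γ} {k : ℕ} {ι κ : Type*} [Finite ι] [Finite κ]
    [MeasurableSpace ι] [MeasurableSpace κ] [MeasurableSingletonClass ι]
    [MeasurableSingletonClass κ] {g : a.X → ι} {h : b.X → κ}
    (hg : Measurable g) (hh : Measurable h) (φ : ι × κ → Fin k) :
    ∃ N, IsStep a b k N fun p => φ (g p.1, h p.2) := by
  obtain ⟨m, ⟨e⟩⟩ := Finite.exists_equiv_fin ι
  obtain ⟨n, ⟨e'⟩⟩ := Finite.exists_equiv_fin κ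
  obtain ⟨p⟩ : Nonempty (a.X × b.X) := (a.prod b).μ.nonempty_of_neZero
  have : Nonempty ι := ⟨g p.1⟩
  have : Nonempty κ := ⟨h p.2⟩
  let u : ι → Fin (max m n) := Fin.castLE (le_max_left m n) ∘ e
  let v : κ → Fin (max m n) := Fin.castLE (le_max_right m n) ∘ e'
  have hu := Function.leftInverse_invFun ((Fin.castLE_injective (le_max_left m n)).comp e.injective)
  have hv := Function.leftInverse_invFun
    ((Fin.castLE_injective (le_max_right m n)).comp e'.injective)
  refine ⟨max m n, u ∘ g, v ∘ h, fun t => φ (Function.invFun u t.1, Function.invFun v t.2),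
    (measurable_of_finite u).comp hg, (measurable_of_finite v).comp hh, fun p => ?_⟩
  simp only [Function.comp_apply]
  rw [hu, hv]

/-- The sets in `X × Y` that are unions of cells of a grid given by finite measurable partitions
of `X` and `Y`. -/
def gridSets (X Y : Type*) [MeasurableSpace X] [MeasurableSpace Y] : Set (Set (X × Y)) :=
  {R | ∃ (m n : ℕ) (g : X → Fin m) (h : Y → Fin n) (T : Set (Fin m × Fin n)),
    Measurable g ∧ Measurable h ∧ R = {p | (g p.1, h p.2) ∈ T}}

section gridSets

variable {X Y : Type*} [MeasurableSpace X] [MeasurableSpace Y]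

lemma measurableSet_of_mem_gridSets {R : Set (X × Y)} (hR : R ∈ gridSets X Y) :
    MeasurableSet R := by
  obtain ⟨m, n, g, h, T, hg, hh, rfl⟩ := hR
  exact ((hg.comp measurable_fst).prodMk (hh.comp measurable_snd)) T.toFinite.measurableSet

lemma prod_mem_gridSets {s : Set X} {t : Set Y} (hs : MeasurableSet s) (ht : MeasurableSet t) :
    s ×ˢ t ∈ gridSets X Y := by
  classical
  refine ⟨2, 2, fun x => if x ∈ s then 1 else 0, fun y => if y ∈ t then 1 else 0, {(1, 1)},
    .ite hs measurable_const measurable_const, .ite ht measurable_const measurable_const, ?_⟩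
  ext ⟨x, y⟩
  by_cases hx : x ∈ s <;> by_cases hy : y ∈ t <;> simp [hx, hy]

lemma isSetAlgebra_gridSets : IsSetAlgebra (gridSets X Y) where
  empty_mem := by simpa using prod_mem_gridSets (X := X) (Y := Y) .empty .empty
  compl_mem := by
    rintro _ ⟨m, n, g, h, T, hg, hh, rfl⟩
    exact ⟨m, n, g, h, Tᶜ, hg, hh, rfl⟩
  union_mem := by
    rintro _ _ ⟨m, n, g, h, T, hg, hh, rfl⟩ ⟨m', n', g', h', T', hg', hh', rfl⟩
    refine ⟨m * m', n * n', fun x => finProdFinEquiv (g x, g' x),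
      fun y => finProdFinEquiv (h y, h' y),
      {t | ((finProdFinEquiv.symm t.1).1, (finProdFinEquiv.symm t.2).1) ∈ T ∨
        ((finProdFinEquiv.symm t.1).2, (finProdFinEquiv.symm t.2).2) ∈ T'},
      (measurable_of_finite _).comp (hg.prodMk hg'), (measurable_of_finite _).comp (hh.prodMk hh'),
      ?_⟩
    ext p
    simp only [Set.mem_union, Set.mem_ofPred_eq, Equiv.symm_apply_apply]

lemma generateFrom_gridSets :
    (Prod.instMeasurableSpace : MeasurableSpace (X × Y)) =
      MeasurableSpace.generateFrom (gridSets X Y) := by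
  refine le_antisymm ?_ (MeasurableSpace.generateFrom_le fun _ => measurableSet_of_mem_gridSets)
  rw [← generateFrom_prod]
  refine MeasurableSpace.generateFrom_mono ?_
  rintro _ ⟨s, hs, t, ht, rfl⟩
  exact prod_mem_gridSets hs ht

lemma exists_gridSets_symmDiff_lt (μ : Measure (X × Y)) [IsFiniteMeasure μ] {s : Set (X × Y)}
    (hs : MeasurableSet s) {ε : ℝ} (hε : 0 < ε) :
    ∃ R ∈ gridSets X Y, μ.real (symmDiff s R) < ε := by
  obtain ⟨R, hR, h⟩ := (Measure.MeasureDense.of_generateFrom_isSetAlgebra_finite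
    isSetAlgebra_gridSets generateFrom_gridSets (μ := μ)).approx s hs (measure_ne_top _ _) ε hε
  exact ⟨R, hR, ENNReal.toReal_lt_of_lt_ofReal h⟩

end gridSets

lemma exists_isStep_measureReal_ne_lt {a b : PMP Γ} {k : ℕ} {f : (a.prod b).X → Fin k}
    (hf : Measurable f) {ε : ℝ} (hε : 0 < ε) :
    ∃ N f', IsStep a b k N f' ∧ (a.prod b).μ.real {p | f p ≠ f' p} < ε := by
  classical
  obtain ⟨p₀⟩ : Nonempty (a.X × b.X) := (a.prod b).μ.nonempty_of_neZero
  have hk : (0 : ℝ) < k := by exact_mod_cast (f p₀).pos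
  have happrox : ∀ i : Fin k, ∃ R ∈ gridSets a.X b.X,
      (a.μ.prod b.μ).real (symmDiff (f ⁻¹' {i}) R) < ε / k := fun i =>
    exists_gridSets_symmDiff_lt (a.μ.prod b.μ) (hf (measurableSet_singleton i)) (by positivity)
  choose R hR hlt using happrox
  choose m n g h T hg hh hRe using hR
  let pick : (Fin k → Prop) → Fin k := fun P => if h : ∃ i, P i then h.choose else f p₀
  have hpick : ∀ (P : Fin k → Prop) (j : Fin k), (∀ i, P i ↔ j = i) → pick P = j := by
    intro P j hP
    have hex : ∃ i, P i := ⟨j, (hP j).2 rfl⟩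
    simp only [pick, dif_pos hex]
    exact ((hP _).1 hex.choose_spec).symm
  obtain ⟨N, hN⟩ := exists_isStep_of_finite (a := a) (b := b)
    (measurable_pi_lambda (fun x i => g i x) hg) (measurable_pi_lambda (fun y i => h i y) hh)
    (fun t => pick fun i => (t.1 i, t.2 i) ∈ T i)
  refine ⟨N, _, hN, ?_⟩
  have hsub : {p : a.X × b.X | f p ≠ pick fun i => (g i p.1, h i p.2) ∈ T i} ⊆
      ⋃ i ∈ (Finset.univ : Finset (Fin k)), symmDiff (f ⁻¹' {i}) (R i) := by
    intro p hp
    by_contra hcon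
    refine hp (hpick _ _ fun i => ?_).symm
    have hi : ¬(f p = i ∧ p ∉ R i ∨ p ∈ R i ∧ f p ≠ i) := fun h' =>
      hcon (Set.mem_biUnion (Finset.mem_coe.2 (Finset.mem_univ i)) h')
    have hmem : p ∈ R i ↔ (g i p.1, h i p.2) ∈ T i := by
      rw [hRe i]
      rfl
    tauto
  calc (a.μ.prod b.μ).real {p : a.X × b.X | f p ≠ pick fun i => (g i p.1, h i p.2) ∈ T i}
      ≤ (a.μ.prod b.μ).real
          (⋃ i ∈ (Finset.univ : Finset (Fin k)), symmDiff (f ⁻¹' {i}) (R i)) :=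
        measureReal_mono hsub (measure_ne_top _ _)
    _ ≤ ∑ i : Fin k, (a.μ.prod b.μ).real (symmDiff (f ⁻¹' {i}) (R i)) :=
        measureReal_biUnion_finset_le _ _
    _ < ∑ _i : Fin k, ε / k :=
        Finset.sum_lt_sum_of_nonempty ⟨f p₀, Finset.mem_univ _⟩ fun i _ => hlt i
    _ = ε := by
        simp only [Finset.sum_const, Finset.card_univ, Fintype.card_fin, nsmul_eq_mul]
        field_simp

lemma exists_stepNet (a b : PMP Γ) (S : Finset Γ) (k : ℕ) {ε : ℝ} (hε : 0 < ε) :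
    ∃ N, 0 < N ∧ StepNet a b S k N ε := by
  have hstep : ∀ v ∈ (a.prod b).C S k, ∃ N f, IsStep a b k N f ∧
      dist v ((a.prod b).M S k f) < ε / 2 := by
    intro v hv
    obtain ⟨_, ⟨f, hf, rfl⟩, hvf⟩ := Metric.mem_closure_iff.1 hv (ε / 4) (by positivity)
    obtain ⟨N, f', hf', hlt⟩ := exists_isStep_measureReal_ne_lt hf (ε := ε / 8) (by positivity)
    refine ⟨N, f', hf', ?_⟩
    have h1 := dist_triangle v ((a.prod b).M S k f) ((a.prod b).M S k f')
    have h2 := (a.prod b).dist_M_le S k hf hf'.measurable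
    linarith
  have htb : TotallyBounded ((a.prod b).C S k) :=
    ((a.prod b).isBounded_C S k).isCompact_closure.totallyBounded.subset subset_closure
  obtain ⟨t, htC, htfin, hcover⟩ := Metric.finite_approx_of_totallyBounded htb (ε / 2) (half_pos hε)
  choose! N hN using hstep
  obtain ⟨K, hK⟩ := (htfin.image N).bddAbove
  refine ⟨K + 1, K.succ_pos, fun v hv => ?_⟩
  obtain ⟨w, hw, hvw⟩ := Set.mem_iUnion₂.1 (hcover hv)
  have hNK : N w ≤ K := hK (Set.mem_image_of_mem N hw)
  obtain ⟨f, hf, hwf⟩ := hN w (htC hw)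
  refine ⟨f, hf.mono (hNK.trans K.le_succ), ?_⟩
  have h1 := dist_triangle v w ((a.prod b).M S k f)
  rw [Metric.mem_ball] at hvw
  linarith

/-- (From the proof of Theorem 4.2, implication (1) ⇒ (2).)  If `α_i → α`, `β_i → β` and
`α_i × β_i → α × β` in the topology of the space of weak equivalence classes (i.e. in the
Hausdorff metric on each `C(·,S',k')`), then for every finite `S ⊆ Γ`, `k ∈ ℕ⁺` and `ε > 0`
one has `N_{S,k}(α_i,β_i,ε) ≤ N_{S,k}(α,β,ε/3)` for all sufficiently large `i`. -/
theorem NStep_le_of_tendsto {Γ : Type} [Group Γ] [Countable Γ] [Infinite Γ]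
    (A B : ℕ → PMP Γ) (a b : PMP Γ)
    (hA : ∀ (S' : Finset Γ) (k' : ℕ), 0 < k' →
      Tendsto (fun i => Metric.hausdorffDist ((A i).C S' k') (a.C S' k')) atTop (𝓝 0))
    (hB : ∀ (S' : Finset Γ) (k' : ℕ), 0 < k' →
      Tendsto (fun i => Metric.hausdorffDist ((B i).C S' k') (b.C S' k')) atTop (𝓝 0))
    (hAB : ∀ (S' : Finset Γ) (k' : ℕ), 0 < k' →
      Tendsto (fun i =>
        Metric.hausdorffDist (((A i).prod (B i)).C S' k') ((a.prod b).C S' k'))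
        atTop (𝓝 0))
    (S : Finset Γ) (k : ℕ) (hk : 0 < k) (ε : ℝ) (hε : 0 < ε) :
    ∀ᶠ i in atTop, NStep (A i) (B i) S k ε ≤ NStep a b S k (ε / 3) := by
  obtain ⟨hN, hnet⟩ : 0 < NStep a b S k (ε / 3) ∧ StepNet a b S k (NStep a b S k (ε / 3)) (ε / 3) :=
    Nat.sInf_mem (exists_stepNet a b S k (by positivity))
  generalize NStep a b S k (ε / 3) = N at hN hnet ⊢
  have hN' : (0 : ℝ) < N := by exact_mod_cast hN
  set δ : ℝ := ε / (6 * (N : ℝ) ^ 4) with hδ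
  have hδ0 : 0 < δ := by positivity
  filter_upwards [(hA S N hN).eventually_lt_const hδ0, (hB S N hN).eventually_lt_const hδ0,
    (hAB S k hk).eventually_lt_const (show 0 < ε / 3 by positivity)] with i hAi hBi hABi
  refine Nat.sInf_le ⟨hN, fun v hv => ?_⟩
  obtain ⟨w, hw, hvw⟩ := (PMP.exists_dist_lt_of_hausdorffDist_C_lt hk hABi).1 v hv
  obtain ⟨f, ⟨g, h, φ, hg, hh, hf⟩, hwf⟩ := hnet w hw
  obtain rfl : f = fun p : a.X × b.X => φ (g p.1, h p.2) := funext hf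
  obtain ⟨g', hg', hgg'⟩ := PMP.exists_dist_M_lt hN hAi hg
  obtain ⟨h', hh', hhh'⟩ := PMP.exists_dist_M_lt hN hBi hh
  refine ⟨fun p => φ (g' p.1, h' p.2), ⟨g', h', φ, hg', hh', fun _ => rfl⟩, ?_⟩
  have hstep := PMP.dist_M_prod_step_le (S := S) hg hh hg' hh' φ
  rw [dist_comm (a.M S N g), dist_comm (b.M S N h)] at hstep
  have hsum : (N : ℝ) ^ 4 * (dist ((A i).M S N g') (a.M S N g) +
      dist ((B i).M S N h') (b.M S N h)) ≤ (N : ℝ) ^ 4 * (δ + δ) := by gcongr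
  have hδε : (N : ℝ) ^ 4 * (δ + δ) = ε / 3 := by
    rw [hδ]
    field_simp
    norm_num
  refine (dist_triangle4 v w ((a.prod b).M S k fun p => φ (g p.1, h p.2)) _).trans_lt ?_
  exact (add_lt_add_of_lt_of_le (add_lt_add hvw hwf) (hstep.trans (hsum.trans_eq hδε))).trans_eq
    (by ring)
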